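/- arXiv:2605.20093 — 20 statements merged into one kernel-verified Lean document; each statement's English description precedes it below -/
import Mathlib

section
/- Let x, y, a, b be positive integers. There exist a lattice parallelogram with side lengths x and y whose area equals 2(a+b), and a lattice parallelogram with side lengths a and b whose area equals 2(x+y) (i.e., an amicable pair of lattice parallelograms), if and only if both x²y² − 4(a+b)² and a²b² − 4(x+y)² are squares of integers. Concretely: there exist vectors p, q ∈ ℤ × ℤ with ‖p‖ = x, ‖q‖ = y and |p₁q₂ − p₂q₁| = 2(a+b), and vectors p', q' ∈ ℤ × ℤ with ‖p'‖ = a, ‖q'‖ = b and |p'₁q'₂ − p'₂q'₁| = 2(x+y), if and only if there exist integers s, t with x²y² − 4(a+b)² = s² and a²b² − 4(x+y)² = t². -/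
namespace GaussianInt

/-- A Gaussian integer whose norm is divisible by the norm of a prime is divisible by that prime or
by its conjugate. -/
lemma exists_norm_eq_and_dvd {π z : GaussianInt} (hπ : Prime π) (h : π.norm ∣ z.norm) :
    ∃ w : GaussianInt, w.norm = π.norm ∧ w ∣ z := by
  have hdvd : π ∣ z * star z := by
    rw [← Zsqrtd.norm_eq_mul_conj]
    refine dvd_trans ?_ (Int.cast_dvd_cast (α := GaussianInt) _ _ h)
    rw [Zsqrtd.norm_eq_mul_conj]
    exact dvd_mul_right _ _
  rcases hπ.dvd_or_dvd hdvd with h₁ | ⟨c, hc⟩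
  · exact ⟨π, rfl, h₁⟩
  · refine ⟨star π, Zsqrtd.norm_conj π, star c, ?_⟩
    rw [← star_star z, hc, star_mul, mul_comm]

lemma prime_of_norm_eq_natPrime {p : ℕ} (hp : p.Prime) {π : GaussianInt} (h : π.norm = p) :
    Prime π := by
  rw [← irreducible_iff_prime]
  refine ⟨fun hu => ?_, fun a b hab => ?_⟩
  · rw [← Zsqrtd.norm_eq_one_iff, h, Int.natAbs_natCast] at hu
    exact hp.one_lt.ne' hu
  · rw [← Zsqrtd.norm_eq_one_iff, ← Zsqrtd.norm_eq_one_iff]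
    have hmul : a.norm.natAbs * b.norm.natAbs = p := by
      rw [← Int.natAbs_mul, ← Zsqrtd.norm_mul, ← hab, h, Int.natAbs_natCast]
    rcases hp.eq_one_or_self_of_dvd _ (Dvd.intro _ hmul) with h₁ | h₁
    · exact Or.inl h₁
    · right
      rw [h₁] at hmul
      exact Nat.eq_of_mul_eq_mul_left hp.pos (by rw [hmul, mul_one])

lemma exists_dvd_norm_eq_sq_of_prime {p : ℕ} (hp : p.Prime) {z : GaussianInt}
    (h : (p : ℤ) ^ 2 ∣ z.norm) : ∃ w : GaussianInt, w.norm = (p : ℤ) ^ 2 ∧ w ∣ z := by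
  have hp0 : (p : ℤ) ≠ 0 := by exact_mod_cast hp.ne_zero
  have : Fact p.Prime := ⟨hp⟩
  by_cases h3 : p % 4 = 3
  · have hnorm : (p : GaussianInt).norm = (p : ℤ) ^ 2 := by
      rw [Zsqrtd.norm_natCast, sq]
    rw [← hnorm] at h ⊢
    exact exists_norm_eq_and_dvd (prime_of_nat_prime_of_mod_four_eq_three p h3) h
  · obtain ⟨m, n, hmn⟩ := Nat.Prime.sq_add_sq h3
    obtain ⟨π, hπ⟩ : ∃ π : GaussianInt, π.norm = p :=
      ⟨⟨m, n⟩, by rw [Zsqrtd.norm_def, ← hmn]; push_cast; ring⟩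
    have hprime := prime_of_norm_eq_natPrime hp hπ
    obtain ⟨w₁, hw₁, c, rfl⟩ :=
      exists_norm_eq_and_dvd hprime (z := z) (hπ ▸ (dvd_pow_self _ two_ne_zero).trans h)
    rw [Zsqrtd.norm_mul, hw₁, hπ, sq] at h
    obtain ⟨w₂, hw₂, hc⟩ :=
      exists_norm_eq_and_dvd hprime (z := c) (hπ ▸ Int.dvd_of_mul_dvd_mul_left hp0 h)
    exact ⟨w₁ * w₂, by rw [Zsqrtd.norm_mul, hw₁, hw₂, hπ, sq], mul_dvd_mul_left w₁ hc⟩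

lemma exists_dvd_norm_eq_sq (n : ℕ) {z : GaussianInt} (h : (n : ℤ) ^ 2 ∣ z.norm) :
    ∃ w : GaussianInt, w.norm = (n : ℤ) ^ 2 ∧ w ∣ z := by
  induction n using induction_on_primes generalizing z with
  | zero =>
    have hz : z.norm = 0 := by simpa using h
    exact ⟨z, by simpa using hz, dvd_rfl⟩
  | one => exact ⟨1, by simp, one_dvd z⟩
  | prime_mul p n hp ih =>
    rw [Nat.cast_mul, mul_pow] at h ⊢
    obtain ⟨w₁, hw₁, c, rfl⟩ := exists_dvd_norm_eq_sq_of_prime hp ((dvd_mul_right _ _).trans h)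
    rw [Zsqrtd.norm_mul, hw₁] at h
    have hp0 : (p : ℤ) ^ 2 ≠ 0 := pow_ne_zero 2 (by exact_mod_cast hp.ne_zero)
    obtain ⟨w₂, hw₂, hc⟩ := ih (Int.dvd_of_mul_dvd_mul_left hp0 h)
    exact ⟨w₁ * w₂, by rw [Zsqrtd.norm_mul, hw₁, hw₂], mul_dvd_mul_left w₁ hc⟩

end GaussianInt

lemma sqrt_intCast_sq_add_sq_eq_iff {m n x : ℤ} (hx : 0 < x) :
    Real.sqrt ((m : ℝ) ^ 2 + (n : ℝ) ^ 2) = (x : ℝ) ↔ m ^ 2 + n ^ 2 = x ^ 2 := by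
  rw [Real.sqrt_eq_iff_eq_sq (by positivity) (by exact_mod_cast hx.le)]
  norm_cast

/-- A lattice parallelogram with side lengths `x`, `y` and area `A` exists iff `x²y² − A²` is a
square. -/
lemma exists_lattice_parallelogram_iff {x y A : ℤ} (hx : 0 < x) (hy : 0 < y) (hA : 0 < A) :
    (∃ p q : ℤ × ℤ,
        Real.sqrt ((p.1 : ℝ) ^ 2 + (p.2 : ℝ) ^ 2) = (x : ℝ) ∧
        Real.sqrt ((q.1 : ℝ) ^ 2 + (q.2 : ℝ) ^ 2) = (y : ℝ) ∧
        |p.1 * q.2 - p.2 * q.1| = A) ↔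
    ∃ s : ℤ, x ^ 2 * y ^ 2 - A ^ 2 = s ^ 2 := by
  simp only [sqrt_intCast_sq_add_sq_eq_iff hx, sqrt_intCast_sq_add_sq_eq_iff hy]
  constructor
  · rintro ⟨p, q, hp, hq, h⟩
    refine ⟨p.1 * q.1 + p.2 * q.2, ?_⟩
    rw [← h, sq_abs, ← hp, ← hq]
    ring
  · rintro ⟨s, hs⟩
    obtain ⟨n, rfl⟩ := Int.eq_ofNat_of_zero_le hx.le
    have hnorm : (⟨s, A⟩ : GaussianInt).norm = (n : ℤ) ^ 2 * y ^ 2 := by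
      rw [Zsqrtd.norm_def]
      linarith
    obtain ⟨u, hu, v, huv⟩ :=
      GaussianInt.exists_dvd_norm_eq_sq n (z := ⟨s, A⟩) (hnorm ▸ dvd_mul_right _ _)
    have hv : v.norm = y ^ 2 := by
      rw [huv, Zsqrtd.norm_mul, hu] at hnorm
      exact mul_left_cancel₀ (pow_ne_zero 2 hx.ne') hnorm
    have him : A = u.re * v.im + u.im * v.re := by
      simpa using congrArg Zsqrtd.im huv
    rw [Zsqrtd.norm_def] at hu hv
    refine ⟨(u.re, -u.im), (v.re, v.im), ?_, ?_, ?_⟩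
    · linarith
    · linarith
    · rw [← abs_of_pos hA, him]
      ring_nf


/-- Amicable pairs of lattice parallelograms with side lengths `x, y` and `a, b`
exist iff `x²y² − 4(a+b)²` and `a²b² − 4(x+y)²` are squares of integers. -/
theorem stmt_0 (x y a b : ℤ) (hx : 0 < x) (hy : 0 < y) (ha : 0 < a) (hb : 0 < b) :
    ((∃ p q : ℤ × ℤ,
        Real.sqrt ((p.1 : ℝ) ^ 2 + (p.2 : ℝ) ^ 2) = (x : ℝ) ∧
        Real.sqrt ((q.1 : ℝ) ^ 2 + (q.2 : ℝ) ^ 2) = (y : ℝ) ∧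
        |p.1 * q.2 - p.2 * q.1| = 2 * (a + b)) ∧
     (∃ p' q' : ℤ × ℤ,
        Real.sqrt ((p'.1 : ℝ) ^ 2 + (p'.2 : ℝ) ^ 2) = (a : ℝ) ∧
        Real.sqrt ((q'.1 : ℝ) ^ 2 + (q'.2 : ℝ) ^ 2) = (b : ℝ) ∧
        |p'.1 * q'.2 - p'.2 * q'.1| = 2 * (x + y))) ↔
    (∃ s t : ℤ, x ^ 2 * y ^ 2 - 4 * (a + b) ^ 2 = s ^ 2 ∧
        a ^ 2 * b ^ 2 - 4 * (x + y) ^ 2 = t ^ 2) := by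
  rw [exists_lattice_parallelogram_iff hx hy (by positivity),
    exists_lattice_parallelogram_iff ha hb (by positivity)]
  simp only [exists_and_left, exists_and_right, mul_pow]
  norm_num
end

section
/- If x and a are positive integers such that both x⁴ − 16a² and a⁴ − 16x² are squares of integers, then x = a, and moreover (x, a) = (4, 4) or (x, a) = (5, 5). In particular, any amicable pair of lattice rhombuses with integer side lengths x and a consists of two equable rhombuses. -/
/-- A square value of `y⁴ - 16b²` splits `4b²` as a product of two positive integers with
sum `y²`; `p` is the smaller of the two factors. -/
theorem exists_smaller_factor {y b s : ℤ} (hb : 0 < b) (h : y ^ 4 - 16 * b ^ 2 = s ^ 2) :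
    ∃ p : ℤ, 1 ≤ p ∧ 2 * p ≤ y ^ 2 ∧ p * (y ^ 2 - p) = 4 * b ^ 2 := by
  wlog hs : 0 ≤ s generalizing s
  · exact this (s := -s) (by rw [h]; ring) (by omega)
  have hpar : Even (y ^ 2 - s) := by
    have he : Even (y ^ 4 - s ^ 2) := ⟨8 * b ^ 2, by linarith⟩
    simpa [Int.even_sub, Int.even_pow] using he
  obtain ⟨p, hp⟩ := hpar
  obtain rfl : s = y ^ 2 - 2 * p := by linarith
  have hprod : p * (y ^ 2 - p) = 4 * b ^ 2 := by linarith
  refine ⟨p, ?_, by linarith, hprod⟩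
  have hpos : 0 < p * (y ^ 2 - p) := by rw [hprod]; positivity
  by_contra! hlt
  nlinarith [sq_nonneg y]

set_option synthInstance.maxSize 4000 in
theorem eq_four_or_five_of_bounded :
    ∀ p : ℕ, p < 9 → ∀ q : ℕ, q < 41 → ∀ x : ℕ, x < 92 → 16 < p * q →
      p * q * (x * x) = q * (p * p) + 4 * (q * q) + 16 * (x * x) → x = 4 ∨ x = 5 := by
  decide +kernel

theorem eq_four_or_five_of_le {x a s t : ℤ} (ha : 0 < a) (hax : a ≤ x)
    (h1 : x ^ 4 - 16 * a ^ 2 = s ^ 2) (h2 : a ^ 4 - 16 * x ^ 2 = t ^ 2) :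
    x = 4 ∨ x = 5 := by
  have hx : 0 < x := by omega
  obtain ⟨p, hp1, hpx, hp⟩ := exists_smaller_factor ha h1
  obtain ⟨q, hq1, hqa, hq⟩ := exists_smaller_factor hx h2
  have hsq : a ^ 2 ≤ x ^ 2 := by gcongr
  have hx2 : 1 ≤ x ^ 2 := by nlinarith
  have ha2 : 1 ≤ a ^ 2 := by nlinarith
  have hp8 : p ≤ 8 := by
    by_contra! hlt
    nlinarith
  have hxa : x ^ 2 ≤ 4 * a ^ 2 + 1 := by nlinarith
  have hq40 : q ≤ 40 := by
    by_contra! hlt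
    nlinarith
  have key : p * q * x ^ 2 = q * p ^ 2 + 4 * q ^ 2 + 16 * x ^ 2 := by
    linear_combination q * hp + 4 * hq
  have hpq : 16 < p * q := by
    by_contra! hle
    nlinarith [mul_le_mul_of_nonneg_right hle (sq_nonneg x), mul_pos hq1 (pow_pos (zero_lt_one.trans_le hp1) 2)]
  have hx92 : x < 92 := by
    by_contra! hge
    have hX : 92 ^ 2 ≤ x ^ 2 := by gcongr
    have hp2 : p ^ 2 ≤ 8 ^ 2 := by gcongr
    have hX' : x ^ 2 ≤ q * p ^ 2 + 4 * q ^ 2 := by nlinarith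
    nlinarith
  lift p to ℕ using by omega
  lift q to ℕ using by omega
  lift x to ℕ using by omega
  have := eq_four_or_five_of_bounded p (by omega) q (by omega) x (by omega)
    (by exact_mod_cast hpq) (by simp only [← sq]; exact_mod_cast key)
  omega

theorem eq_and_eq_four_or_five_of_le {x a s t : ℤ} (ha : 0 < a) (hax : a ≤ x)
    (h1 : x ^ 4 - 16 * a ^ 2 = s ^ 2) (h2 : a ^ 4 - 16 * x ^ 2 = t ^ 2) :
    (x = 4 ∧ a = 4) ∨ (x = 5 ∧ a = 5) := by
  have ht := sq_nonneg t
  rw [← h2] at ht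
  rcases eq_four_or_five_of_le ha hax h1 h2 with rfl | rfl
  · interval_cases a <;> omega
  · interval_cases a <;> omega

/-- If `x⁴ − 16a²` and `a⁴ − 16x²` are both squares of integers (for positive
integers `x, a`), then `x = a` and `(x, a)` is `(4, 4)` or `(5, 5)`. -/
theorem stmt_1 (x a : ℤ) (hx : 0 < x) (ha : 0 < a)
    (h1 : ∃ s : ℤ, x ^ 4 - 16 * a ^ 2 = s ^ 2)
    (h2 : ∃ t : ℤ, a ^ 4 - 16 * x ^ 2 = t ^ 2) :
    x = a ∧ ((x = 4 ∧ a = 4) ∨ (x = 5 ∧ a = 5)) := by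
  obtain ⟨s, hs⟩ := h1
  obtain ⟨t, ht⟩ := h2
  rcases le_total a x with h | h
  · have := eq_and_eq_four_or_five_of_le ha h hs ht
    omega
  · have := eq_and_eq_four_or_five_of_le hx h ht hs
    omega
end

section
/- Let p, q, p', q' ∈ ℤ × ℤ with ‖p‖ = ‖q‖, ‖p'‖ = ‖q'‖, |p₁q₂ − p₂q₁| = 4‖p'‖, and |p'₁q'₂ − p'₂q'₁| = 4‖p‖ (an amicable pair of lattice rhombuses). Then ‖p‖ = ‖p'‖ and |p₁q₂ − p₂q₁| = 4‖p‖; that is, both rhombuses are equable. -/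
/-- If `s ^ 4 - 16 * t ^ 2` and `t ^ 4 - 16 * s ^ 2` are both squares, then `t ≤ s`. -/
lemma le_of_sq_add_eq_pow_four {s t e f : ℤ} (hs : 0 ≤ s) (ht : 0 ≤ t)
    (he : e ^ 2 + 16 * t ^ 2 = s ^ 4) (hf : f ^ 2 + 16 * s ^ 2 = t ^ 4) : t ≤ s := by
  by_contra! hst
  wlog hf0 : 0 ≤ f generalizing f
  · exact this (f := -f) (by linarith [neg_sq f]) (by linarith)
  have hs4 : 4 * t ≤ s ^ 2 := by
    apply le_of_sq_le_sq _ (sq_nonneg s)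
    nlinarith [sq_nonneg e]
  have hs5 : 5 ≤ s := by nlinarith
  have hpar : Even (t ^ 2 - f) := by
    have h : Even (t ^ 4 - f ^ 2) := ⟨8 * s ^ 2, by linarith⟩
    simpa [Int.even_sub, Int.even_pow] using h
  obtain ⟨j, hj⟩ := hpar
  have hprod : j * (t ^ 2 - j) = 4 * s ^ 2 := by
    obtain rfl : f = t ^ 2 - 2 * j := by linarith
    linarith
  have hsum : 0 ≤ t ^ 2 - 2 * j := by linarith
  have hj0 : 0 < j := by
    by_contra! h
    nlinarith
  have hj8 : j < 8 := by
    by_contra! h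
    nlinarith
  interval_cases j
  · have h1 : 2 * s < t := by nlinarith
    nlinarith
  · -- Here `e ^ 2 = (s ^ 2 - 16) ^ 2 - 288`, which bounds `s`.
    have ht2 : t ^ 2 = 2 * s ^ 2 + 2 := by linarith
    have he2 : e ^ 2 = (s ^ 2 - 16) ^ 2 - 288 := by linarith
    have hs13 : s < 13 := by
      by_contra! h
      have habs : |e| ^ 2 = (s ^ 2 - 16) ^ 2 - 288 := by rw [sq_abs, he2]
      have h1 : |e| < s ^ 2 - 16 := by
        apply lt_of_pow_lt_pow_left₀ 2 (by nlinarith)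
        linarith
      nlinarith [abs_nonneg e]
    have ht20 : t < 20 := by nlinarith
    interval_cases s <;> interval_cases t <;> try omega
    have h1 : e < 29 := by nlinarith
    have h2 : -29 < e := by nlinarith
    interval_cases e <;> omega
  · obtain ⟨u, rfl⟩ : (3 : ℤ) ∣ s := by
      apply Int.prime_three.dvd_of_dvd_pow (n := 2)
      omega
    obtain ⟨v, rfl⟩ : (3 : ℤ) ∣ t := by
      apply Int.prime_three.dvd_of_dvd_pow (n := 2)
      ring_nf at hprod ⊢
      omega
    rcases Int.even_or_odd' v with ⟨w, rfl | rfl⟩ <;> ring_nf at hprod <;> omega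
  all_goals nlinarith

/-- If four times the norm of a lattice vector is an integer, then so is the norm. -/
lemma exists_norm_eq_intCast {m a b : ℤ} (h : (m : ℝ) = 4 * √((a : ℝ) ^ 2 + (b : ℝ) ^ 2)) :
    ∃ s : ℤ, 0 ≤ s ∧ √((a : ℝ) ^ 2 + (b : ℝ) ^ 2) = s := by
  have hm : m ^ 2 = 4 ^ 2 * (a ^ 2 + b ^ 2) := by
    have : (m : ℝ) ^ 2 = 4 ^ 2 * ((a : ℝ) ^ 2 + (b : ℝ) ^ 2) := by
      rw [h, mul_pow, Real.sq_sqrt (by positivity)]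
    exact_mod_cast this
  obtain ⟨s, rfl⟩ : 4 ∣ m := (Int.pow_dvd_pow_iff two_ne_zero).1 ⟨_, hm⟩
  have hs : √((a : ℝ) ^ 2 + (b : ℝ) ^ 2) = s := by
    push_cast at h
    linarith
  exact ⟨s, by exact_mod_cast hs ▸ Real.sqrt_nonneg _, hs⟩

/-- If a lattice rhombus has side `s` and area `4 * t`, then `s ^ 4 - 16 * t ^ 2` is a square. -/
lemma exists_sq_add_eq_pow_four {p q : ℤ × ℤ} {s t : ℤ}
    (hp : √((p.1 : ℝ) ^ 2 + (p.2 : ℝ) ^ 2) = s) (hq : √((q.1 : ℝ) ^ 2 + (q.2 : ℝ) ^ 2) = s)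
    (h : |(p.1 : ℝ) * q.2 - p.2 * q.1| = 4 * t) :
    ∃ e : ℤ, e ^ 2 + 16 * t ^ 2 = s ^ 4 := by
  have hp2 : (p.1 : ℝ) ^ 2 + (p.2 : ℝ) ^ 2 = s ^ 2 := by
    rw [← hp, Real.sq_sqrt (by positivity)]
  have hq2 : (q.1 : ℝ) ^ 2 + (q.2 : ℝ) ^ 2 = s ^ 2 := by
    rw [← hq, Real.sq_sqrt (by positivity)]
  have h2 : ((p.1 : ℝ) * q.2 - p.2 * q.1) ^ 2 = (4 * t) ^ 2 := by rw [← h, sq_abs]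
  refine ⟨p.1 * q.1 + p.2 * q.2, ?_⟩
  have : ((p.1 : ℝ) * q.1 + p.2 * q.2) ^ 2 + 16 * (t : ℝ) ^ 2 = (s : ℝ) ^ 4 := by
    linear_combination -h2 + ((q.1 : ℝ) ^ 2 + (q.2 : ℝ) ^ 2) * hp2 + (s : ℝ) ^ 2 * hq2
  exact_mod_cast this

/-- An amicable pair of lattice rhombuses consists of two equable rhombuses. -/
theorem stmt_2 (p q p' q' : ℤ × ℤ)
    (hpq : Real.sqrt ((p.1 : ℝ) ^ 2 + (p.2 : ℝ) ^ 2)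
         = Real.sqrt ((q.1 : ℝ) ^ 2 + (q.2 : ℝ) ^ 2))
    (hpq' : Real.sqrt ((p'.1 : ℝ) ^ 2 + (p'.2 : ℝ) ^ 2)
          = Real.sqrt ((q'.1 : ℝ) ^ 2 + (q'.2 : ℝ) ^ 2))
    (h1 : (|p.1 * q.2 - p.2 * q.1| : ℝ)
        = 4 * Real.sqrt ((p'.1 : ℝ) ^ 2 + (p'.2 : ℝ) ^ 2))
    (h2 : (|p'.1 * q'.2 - p'.2 * q'.1| : ℝ)
        = 4 * Real.sqrt ((p.1 : ℝ) ^ 2 + (p.2 : ℝ) ^ 2)) :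
    Real.sqrt ((p.1 : ℝ) ^ 2 + (p.2 : ℝ) ^ 2)
      = Real.sqrt ((p'.1 : ℝ) ^ 2 + (p'.2 : ℝ) ^ 2) ∧
    (|p.1 * q.2 - p.2 * q.1| : ℝ)
      = 4 * Real.sqrt ((p.1 : ℝ) ^ 2 + (p.2 : ℝ) ^ 2) := by
  obtain ⟨t, ht, hp't⟩ := exists_norm_eq_intCast (m := |p.1 * q.2 - p.2 * q.1|)
    (by push_cast; exact h1)
  obtain ⟨s, hs, hps⟩ := exists_norm_eq_intCast (m := |p'.1 * q'.2 - p'.2 * q'.1|)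
    (by push_cast; exact h2)
  obtain ⟨e, he⟩ := exists_sq_add_eq_pow_four hps (hpq ▸ hps) (hp't ▸ h1)
  obtain ⟨f, hf⟩ := exists_sq_add_eq_pow_four hp't (hpq' ▸ hp't) (hps ▸ h2)
  have hst : s = t :=
    le_antisymm (le_of_sq_add_eq_pow_four ht hs hf he) (le_of_sq_add_eq_pow_four hs ht he hf)
  have hnorm : √((p.1 : ℝ) ^ 2 + (p.2 : ℝ) ^ 2) = √((p'.1 : ℝ) ^ 2 + (p'.2 : ℝ) ^ 2) := by
    rw [hps, hp't, hst]
  exact ⟨hnorm, by rw [h1, hnorm]⟩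
end

section
/- Let κ, m, n be positive integers and s a nonnegative integer satisfying κ⁴m⁴n⁴ − 32κ(m² + n²) = s². If κ²m²n² − s = 2β for some positive integer β, then κ divides β² and β³ + 64 = (βκm² − 8)(βκn² − 8). -/
theorem stmt_3 (κ m n s β : ℤ) (hκ : 0 < κ) (hm : 0 < m) (hn : 0 < n)
    (hs : 0 ≤ s) (heq : κ ^ 4 * m ^ 4 * n ^ 4 - 32 * κ * (m ^ 2 + n ^ 2) = s ^ 2)
    (hβ : 0 < β) (h2β : κ ^ 2 * m ^ 2 * n ^ 2 - s = 2 * β) :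
    κ ∣ β ^ 2 ∧ β ^ 3 + 64 = (β * κ * m ^ 2 - 8) * (β * κ * n ^ 2 - 8) := by
  have hs_eq : s = κ ^ 2 * m ^ 2 * n ^ 2 - 2 * β := by linarith
  subst hs_eq
  have key : β ^ 2 = κ * (β * κ * m ^ 2 * n ^ 2 - 8 * (m ^ 2 + n ^ 2)) := by
    linarith
  exact ⟨⟨_, key⟩, by linear_combination β * key⟩
end

section
/- Let κ, m, n be positive integers and s a nonnegative integer satisfying κ⁴m⁴n⁴ − 32κ(m² + n²) = s². If β is a positive integer with κ²m²n² − s ≥ 2β, then β³ + 64 ≥ (βκm² − 8)(βκn² − 8). -/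
theorem stmt_4 (κ m n s β : ℤ) (hκ : 0 < κ) (hm : 0 < m) (hn : 0 < n)
    (hs : 0 ≤ s) (heq : κ ^ 4 * m ^ 4 * n ^ 4 - 32 * κ * (m ^ 2 + n ^ 2) = s ^ 2)
    (hβ : 0 < β) (h2β : κ ^ 2 * m ^ 2 * n ^ 2 - s ≥ 2 * β) :
    β ^ 3 + 64 ≥ (β * κ * m ^ 2 - 8) * (β * κ * n ^ 2 - 8) := by
  have hsq : s ^ 2 ≤ (κ ^ 2 * m ^ 2 * n ^ 2 - 2 * β) ^ 2 :=
    pow_le_pow_left₀ hs (by linarith) 2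
  have hquad : 0 ≤ β ^ 2 - β * (κ ^ 2 * m ^ 2 * n ^ 2) + 8 * κ * (m ^ 2 + n ^ 2) := by
    linarith
  linarith [mul_nonneg hβ.le hquad]
end

section
/- Let κ, m, n be positive integers and s a nonnegative integer satisfying κ⁴m⁴n⁴ − 32κ(m² + n²) = s². Then (as integers) (κm² − 2)(κn² − 2) ≤ 8. -/
/-- A product of two positive integers that is a perfect square cannot satisfy
`8 * (a + b) = j * (a * b - j)` with `1 ≤ j ≤ 3`. -/
theorem four_le_of_eight_mul_add_eq {a b t j : ℤ} (ha : 0 < a) (hb : 0 < b)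
    (hab : a * b = t ^ 2) (hj : 0 < j) (h : 8 * (a + b) = j * (a * b - j)) : 4 ≤ j := by
  by_contra! hlt
  have h5 : t ^ 2 % 5 = 0 ∨ t ^ 2 % 5 = 1 ∨ t ^ 2 % 5 = 4 := by
    have : t % 5 = 0 ∨ t % 5 = 1 ∨ t % 5 = 2 ∨ t % 5 = 3 ∨ t % 5 = 4 := by omega
    rcases this with h | h | h | h | h <;> simp [pow_two, Int.mul_emod, h]
  have h4 : t ^ 2 % 4 = 0 ∨ t ^ 2 % 4 = 1 := by
    have : t % 4 = 0 ∨ t % 4 = 1 ∨ t % 4 = 2 ∨ t % 4 = 3 := by omega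
    rcases this with h | h | h | h <;> simp [pow_two, Int.mul_emod, h]
  rw [← hab] at h4 h5
  interval_cases j
  · have hle : a - 8 ≤ 65 := Int.le_of_dvd (by norm_num) ⟨b - 8, by linarith⟩
    have hle' : a ≤ 73 := by linarith
    interval_cases a <;> omega
  · have hle : a - 4 ≤ 18 := Int.le_of_dvd (by norm_num) ⟨b - 4, by linarith⟩
    have hle' : a ≤ 22 := by linarith
    interval_cases a <;> omega
  · have hle : 3 * a - 8 ≤ 91 := Int.le_of_dvd (by norm_num) ⟨3 * b - 8, by linarith⟩
    have hle' : a ≤ 33 := by linarith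
    interval_cases a <;> omega

theorem stmt_5 (κ m n s : ℤ) (hκ : 0 < κ) (hm : 0 < m) (hn : 0 < n)
    (hs : 0 ≤ s) (heq : κ ^ 4 * m ^ 4 * n ^ 4 - 32 * κ * (m ^ 2 + n ^ 2) = s ^ 2) :
    (κ * m ^ 2 - 2) * (κ * n ^ 2 - 2) ≤ 8 := by
  have ha : 0 < κ * m ^ 2 := by positivity
  have hb : 0 < κ * n ^ 2 := by positivity
  have hab : κ * m ^ 2 * (κ * n ^ 2) = (κ * m * n) ^ 2 := by ring
  have key : (κ * m ^ 2 * (κ * n ^ 2)) ^ 2 - 32 * (κ * m ^ 2 + κ * n ^ 2) = s ^ 2 := by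
    rw [← heq]; ring
  generalize κ * m ^ 2 = a at *
  generalize κ * n ^ 2 = b at *
  have hT : 0 < a * b := mul_pos ha hb
  have hlt : s < a * b := by nlinarith
  obtain ⟨j, hj⟩ : (2 : ℤ) ∣ a * b - s := by
    have h2 : (2 : ℤ) ∣ (a * b) ^ 2 - s ^ 2 := ⟨16 * (a + b), by linarith⟩
    rw [sq_sub_sq] at h2
    rcases Int.prime_two.dvd_or_dvd h2 with h | h <;> omega
  have hs' : s = a * b - 2 * j := by linarith
  have hj4 : 4 ≤ j := by
    refine four_le_of_eight_mul_add_eq ha hb hab (by linarith) ?_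
    rw [hs'] at key
    linarith
  have hmono : 4 * (a * b - 4) ≤ 8 * (a + b) := by
    rw [hs'] at key
    have := mul_nonneg (sub_nonneg.2 hj4) (by linarith : 0 ≤ a * b - j - 4)
    linarith
  linarith
end

section
/- Suppose A, c, d are positive integers and A² − 2cA − d is the square of an integer. Then 2A ≤ (c + 1)² + d. -/
theorem stmt_6 (A c d : ℤ) (hA : 0 < A) (hc : 0 < c) (hd : 0 < d)
    (h : ∃ s : ℤ, A ^ 2 - 2 * c * A - d = s ^ 2) :
    2 * A ≤ (c + 1) ^ 2 + d := by
  obtain ⟨s, hs⟩ := h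
  rcases le_or_gt A c with hAc | hAc
  · nlinarith [sq_nonneg c]
  · have hlt : |s| < A - c := abs_lt_of_sq_lt_sq (by nlinarith [sq_nonneg c]) (by linarith)
    have hprod : 0 ≤ (A - c - |s| - 1) * (A - c + |s| - 1) :=
      mul_nonneg (by linarith) (by linarith [abs_nonneg s])
    nlinarith [sq_abs s]
end

section
/- Let κ, m, n be positive integers with m and n coprime, and let s be a nonnegative integer satisfying κ⁴m⁴n⁴ − 32κ(m² + n²) = s². Then κ = 4, m = 1, and n = 1. -/
/-- The finitely many candidates for `j (κ² n² m² - j) = 8 κ (m² + n²)` with `j κ n² ≤ 32`. -/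
theorem finite_search : ∀ j : Fin 33, ∀ k : Fin 33, ∀ n : Fin 6,
    0 < j.val * k.val * n.val ^ 2 ∧ j.val * k.val * n.val ^ 2 ≤ 32 → ∀ m : Fin 36,
      n.val ≤ m.val ∧ j.val * k.val ^ 2 * n.val ^ 2 * m.val ^ 2 =
        8 * k.val * (m.val ^ 2 + n.val ^ 2) + j.val ^ 2 ∧ Nat.gcd m n = 1 →
      k.val = 4 ∧ m.val = 1 ∧ n.val = 1 := by
  decide +kernel

theorem eq_of_le (κ m n s : ℤ) (hκ : 0 < κ) (hn : 0 < n) (hnm : n ≤ m)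
    (hcop : IsCoprime m n) (hs : 0 ≤ s)
    (heq : κ ^ 4 * m ^ 4 * n ^ 4 - 32 * κ * (m ^ 2 + n ^ 2) = s ^ 2) :
    κ = 4 ∧ m = 1 ∧ n = 1 := by
  have hm : 0 < m := by lia
  have hpos : 0 < 32 * κ * (m ^ 2 + n ^ 2) := by positivity
  have hApos : 0 < κ ^ 2 * m ^ 2 * n ^ 2 := by positivity
  have hfac : (κ ^ 2 * m ^ 2 * n ^ 2 - s) * (κ ^ 2 * m ^ 2 * n ^ 2 + s)
      = 32 * κ * (m ^ 2 + n ^ 2) := by linear_combination heq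
  have heven : Even (κ ^ 2 * m ^ 2 * n ^ 2 - s) := by
    have h : Even ((κ ^ 2 * m ^ 2 * n ^ 2 - s) * (κ ^ 2 * m ^ 2 * n ^ 2 + s)) := by
      rw [hfac]
      exact ⟨16 * κ * (m ^ 2 + n ^ 2), by ring⟩
    rcases Int.even_mul.mp h with h | h
    · exact h
    · rwa [Int.even_sub, ← Int.even_add]
  obtain ⟨j, hj⟩ := heven
  have hs_eq : s = κ ^ 2 * m ^ 2 * n ^ 2 - 2 * j := by linarith
  have hj0 : 0 < j := by
    have : 0 < κ ^ 2 * m ^ 2 * n ^ 2 - s :=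
      pos_of_mul_pos_left (hfac ▸ hpos) (by linarith)
    lia
  have key : j * κ ^ 2 * n ^ 2 * m ^ 2 = 8 * κ * (m ^ 2 + n ^ 2) + j ^ 2 := by
    rw [hs_eq] at hfac
    linarith
  have hsq : n ^ 2 ≤ m ^ 2 := by gcongr
  have hbound : j * κ * n ^ 2 ≤ 32 := by
    have h1 : j * (κ ^ 2 * m ^ 2 * n ^ 2) ≥ j * (2 * j) :=
      mul_le_mul_of_nonneg_left (by linarith) hj0.le
    have h2 : κ * n ^ 2 ≤ κ * m ^ 2 := by gcongr
    have h3 : (j * κ * n ^ 2) * (κ * m ^ 2) ≤ 32 * (κ * m ^ 2) := by linarith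
    exact le_of_mul_le_mul_right h3 (by positivity)
  have hjle : j ≤ 32 := by
    have : 1 ≤ κ * n ^ 2 := Order.one_le_iff_pos.mpr (by positivity)
    nlinarith
  have hknle : κ * n ^ 2 ≤ 32 := by
    have : 0 < κ * n ^ 2 := by positivity
    nlinarith
  have hκle : κ ≤ 32 := by
    have : 1 ≤ n ^ 2 := Order.one_le_iff_pos.mpr (by positivity)
    nlinarith
  have hnle : n < 6 := by nlinarith
  have hkey : κ * m ^ 2 * (j * κ * n ^ 2 - 8) = 8 * (κ * n ^ 2) + j ^ 2 := by
    linear_combination key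
  have ht : 0 < j * κ * n ^ 2 - 8 :=
    pos_of_mul_pos_right (by rw [hkey]; positivity) (by positivity : 0 ≤ κ * m ^ 2)
  have hmle : m < 36 := by
    have h1 : κ * m ^ 2 ≤ 8 * (κ * n ^ 2) + j ^ 2 := by
      rw [← hkey]
      exact le_mul_of_one_le_right (by positivity) ht
    have h2 : m ^ 2 ≤ κ * m ^ 2 := le_mul_of_one_le_left (by positivity) hκ
    nlinarith
  have hgcd : Int.gcd m n = 1 := Int.isCoprime_iff_gcd_eq_one.mp hcop
  have hjkn : 0 < j * κ * n ^ 2 := by positivity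
  lift j to ℕ using hj0.le
  lift κ to ℕ using hκ.le
  lift m to ℕ using hm.le
  lift n to ℕ using hn.le
  rw [Int.gcd_natCast_natCast] at hgcd
  exact_mod_cast finite_search ⟨j, by lia⟩ ⟨κ, by lia⟩ ⟨n, by lia⟩
    ⟨by exact_mod_cast hjkn, by exact_mod_cast hbound⟩ ⟨m, by lia⟩
    ⟨by exact_mod_cast hnm, by exact_mod_cast key, hgcd⟩

theorem stmt_7 (κ m n s : ℤ) (hκ : 0 < κ) (hm : 0 < m) (hn : 0 < n)
    (hcop : IsCoprime m n) (hs : 0 ≤ s)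
    (heq : κ ^ 4 * m ^ 4 * n ^ 4 - 32 * κ * (m ^ 2 + n ^ 2) = s ^ 2) :
    κ = 4 ∧ m = 1 ∧ n = 1 := by
  rcases le_total n m with h | h
  · exact eq_of_le κ m n s hκ hn h hcop hs heq
  · obtain ⟨h1, h2, h3⟩ := eq_of_le κ n m s hκ hm h hcop.symm hs (by linear_combination heq)
    exact ⟨h1, h3, h2⟩
end

section
/- Let k, μ, n be positive integers with k odd, and let s be a nonnegative integer satisfying k⁴μ⁴n⁴ − 16k(4μ² + n²) = s². If k²μ²n² − s = 2β for some positive integer β, then k divides β² and β³ + 64 = (βkμ² − 4)(βkn² − 16). -/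
theorem stmt_8 (k μ n s β : ℤ) (hk : 0 < k) (hkodd : Odd k) (hμ : 0 < μ)
    (hn : 0 < n) (hs : 0 ≤ s)
    (heq : k ^ 4 * μ ^ 4 * n ^ 4 - 16 * k * (4 * μ ^ 2 + n ^ 2) = s ^ 2)
    (hβ : 0 < β) (h2β : k ^ 2 * μ ^ 2 * n ^ 2 - s = 2 * β) :
    k ∣ β ^ 2 ∧ β ^ 3 + 64 = (β * k * μ ^ 2 - 4) * (β * k * n ^ 2 - 16) := by
  have hquad : β ^ 2 = k * (β * k * μ ^ 2 * n ^ 2 - 4 * (4 * μ ^ 2 + n ^ 2)) := by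
    obtain rfl : s = k ^ 2 * μ ^ 2 * n ^ 2 - 2 * β := by linarith
    linarith
  exact ⟨⟨_, hquad⟩, by linear_combination β * hquad⟩
end

section
/- Let k, μ, n be positive integers with k odd, and let s be a nonnegative integer satisfying k⁴μ⁴n⁴ − 16k(4μ² + n²) = s². If β is a positive integer with k²μ²n² − s ≥ 2β, then β³ + 64 ≥ (βkμ² − 4)(βkn² − 16). -/
theorem stmt_9 (k μ n s β : ℤ) (hk : 0 < k) (hkodd : Odd k) (hμ : 0 < μ)
    (hn : 0 < n) (hs : 0 ≤ s)
    (heq : k ^ 4 * μ ^ 4 * n ^ 4 - 16 * k * (4 * μ ^ 2 + n ^ 2) = s ^ 2)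
    (hβ : 0 < β) (h2β : k ^ 2 * μ ^ 2 * n ^ 2 - s ≥ 2 * β) :
    β ^ 3 + 64 ≥ (β * k * μ ^ 2 - 4) * (β * k * n ^ 2 - 16) := by
  have hprod : 0 ≤ (k ^ 2 * μ ^ 2 * n ^ 2 - 2 * β - s) * (k ^ 2 * μ ^ 2 * n ^ 2 - 2 * β + s) :=
    mul_nonneg (by linarith) (by linarith)
  have hle : β * (k ^ 2 * μ ^ 2 * n ^ 2) - β ^ 2 ≤ 4 * (k * (4 * μ ^ 2 + n ^ 2)) := by
    linarith
  have hmul := mul_le_mul_of_nonneg_left hle hβ.le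
  linarith
end

section
/- Let k, μ, n be positive integers with k odd, and let s be a nonnegative integer satisfying k⁴μ⁴n⁴ − 16k(4μ² + n²) = s². Then (as integers) (5kμ² − 4)(5kn² − 16) ≤ 189. -/
/-- An odd positive integer dividing `16` equals `1`. -/
theorem eq_one_of_odd_of_dvd_sixteen {k : ℤ} (hk : 0 < k) (hkodd : Odd k) (h : k ∣ 16) :
    k = 1 := by
  have hle : k ≤ 16 := Int.le_of_dvd (by norm_num) h
  obtain ⟨j, rfl⟩ := hkodd
  have h0 : 0 ≤ j := by omega
  have h8 : j ≤ 7 := by omega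
  interval_cases j <;> revert h <;> decide

/-- The equation `(a ^ 2 - 2) * (b ^ 2 - 8) = 18` has no solution in positive integers. -/
theorem sq_sub_two_mul_sq_sub_eight_ne {a b : ℤ} (ha : 0 < a) (hb : 0 < b) :
    (a ^ 2 - 2) * (b ^ 2 - 8) ≠ 18 := by
  intro h
  have hb5 : b ≤ 5 := by
    by_contra! hb6
    rcases (by omega : a = 1 ∨ 2 ≤ a) with rfl | ha2
    · nlinarith
    · have h1 : 2 ≤ a ^ 2 - 2 := by nlinarith
      have h2 : 28 ≤ b ^ 2 - 8 := by nlinarith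
      nlinarith
  have ha5 : a ≤ 5 := by
    by_contra! ha6
    have h1 : 34 ≤ a ^ 2 - 2 := by nlinarith
    interval_cases b <;> omega
  interval_cases b <;> interval_cases a <;> omega

/-- The equation `(a ^ 2 - 1) * (b ^ 2 - 4) = 8` has no solution in positive integers. -/
theorem sq_sub_one_mul_sq_sub_four_ne {a b : ℤ} (ha : 0 < a) (hb : 0 < b) :
    (a ^ 2 - 1) * (b ^ 2 - 4) ≠ 8 := by
  intro h
  rcases (by omega : a = 1 ∨ 2 ≤ a) with rfl | ha2
  · norm_num at h
  have h1 : 3 ≤ a ^ 2 - 1 := by nlinarith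
  rcases (by omega : b = 1 ∨ b = 2 ∨ 3 ≤ b) with rfl | rfl | hb3
  · omega
  · omega
  · have h2 : 5 ≤ b ^ 2 - 4 := by nlinarith
    nlinarith

/-- The complementary factor `t` in `t * ((k * μ * n) ^ 2 - t) = 4 * k * (4 * μ ^ 2 + n ^ 2)`
is at least `5`. -/
theorem five_le_of_mul_sub_eq {k μ n t : ℤ} (hk : 0 < k) (hkodd : Odd k) (hμ : 0 < μ)
    (hn : 0 < n) (ht : 0 < t)
    (h : t * ((k * μ * n) ^ 2 - t) = 4 * (k * (4 * μ ^ 2 + n ^ 2))) : 5 ≤ t := by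
  by_contra! ht5
  have hm : (k * μ * n) % 2 = 0 ∨ (k * μ * n) ^ 2 % 8 = 1 := by
    rcases Int.even_or_odd (k * μ * n) with he | ho
    · exact Or.inl (Int.even_iff.mp he)
    · obtain ⟨c, hc⟩ := ho
      obtain ⟨d, hd⟩ := Int.even_mul_succ_self c
      have : (k * μ * n) ^ 2 = 8 * d + 1 := by rw [hc]; linear_combination 4 * hd
      omega
  have hm4 : (k * μ * n) ^ 2 % 4 = 0 ∨ (k * μ * n) ^ 2 % 8 = 1 := by
    refine hm.imp_left fun he => ?_
    obtain ⟨c, hc⟩ := Int.dvd_of_emod_eq_zero he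
    rw [hc, show (2 * c) ^ 2 = 4 * c ^ 2 by ring]
    omega
  have hdvd : k ∣ t ^ 2 :=
    ⟨t * k * μ ^ 2 * n ^ 2 - 4 * (4 * μ ^ 2 + n ^ 2), by linear_combination -h⟩
  interval_cases t
  · have hodd : (k * μ * n) ^ 2 % 8 = 1 := by omega
    have ho : Odd (k * μ * n) := by
      have : Odd ((k * μ * n) ^ 2) := by rw [Int.odd_iff]; omega
      exact Int.odd_pow.mp this |>.resolve_right (by norm_num)
    have hno : Odd n := (Int.odd_mul.mp ho).2
    have : Odd (k * (4 * μ ^ 2 + n ^ 2)) :=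
      hkodd.mul (Even.add_odd ⟨2 * μ ^ 2, by ring⟩ hno.pow)
    rw [Int.odd_iff] at this
    omega
  · obtain rfl := eq_one_of_odd_of_dvd_sixteen hk hkodd (hdvd.trans (by norm_num))
    exact sq_sub_two_mul_sq_sub_eight_ne hμ hn (by linarith)
  · omega
  · obtain rfl := eq_one_of_odd_of_dvd_sixteen hk hkodd (hdvd.trans (by norm_num))
    exact sq_sub_one_mul_sq_sub_four_ne hμ hn (by linarith)

theorem stmt_10 (k μ n s : ℤ) (hk : 0 < k) (hkodd : Odd k) (hμ : 0 < μ)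
    (hn : 0 < n) (hs : 0 ≤ s)
    (heq : k ^ 4 * μ ^ 4 * n ^ 4 - 16 * k * (4 * μ ^ 2 + n ^ 2) = s ^ 2) :
    (5 * k * μ ^ 2 - 4) * (5 * k * n ^ 2 - 16) ≤ 189 := by
  have hpos : 0 < k * (4 * μ ^ 2 + n ^ 2) := by positivity
  have hlt : s < (k * μ * n) ^ 2 := by
    refine lt_of_pow_lt_pow_left₀ 2 (by positivity) ?_
    linarith
  have heven : Even ((k * μ * n) ^ 2 - s) := by
    have h : Even (((k * μ * n) ^ 2) ^ 2 - s ^ 2) :=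
      ⟨8 * (k * (4 * μ ^ 2 + n ^ 2)), by linear_combination heq⟩
    rw [Int.even_sub, Int.even_pow' (m := (k * μ * n) ^ 2) two_ne_zero,
      Int.even_pow' (m := s) two_ne_zero] at h
    exact Int.even_sub.mpr h
  obtain ⟨t, ht⟩ := heven
  obtain rfl : s = (k * μ * n) ^ 2 - 2 * t := by linarith
  have h : t * ((k * μ * n) ^ 2 - t) = 4 * (k * (4 * μ ^ 2 + n ^ 2)) := by
    linarith
  have ht5 : 5 ≤ t := five_le_of_mul_sub_eq hk hkodd hμ hn (by linarith) h
  have hprod : 0 ≤ (t - 5) * ((k * μ * n) ^ 2 - t - 5) :=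
    mul_nonneg (by linarith) (by linarith)
  linarith
end

section
/- Let k, μ, n be positive integers with k odd and with 2μ and n coprime (so in particular n is odd), and let s be a nonnegative integer satisfying k⁴μ⁴n⁴ − 16k(4μ² + n²) = s². Then k = 5, μ = 1, and n = 1. -/
/-- If `(e, k, μ, n)` is a positive solution of `e (k² μ² n² - e) = 4 k (4 μ² + n²)` with `k`, `n`
odd and `2 μ`, `n` coprime, then `(k, μ, n) = (5, 1, 1)`. -/
def SolutionIsTrivial (e k μ n : ℕ) : Prop :=
  0 < e ∧ k % 2 = 1 ∧ n % 2 = 1 ∧ 0 < μ ∧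
    e * (k ^ 2 * μ ^ 2 * n ^ 2) = 4 * k * (4 * μ ^ 2 + n ^ 2) + e ^ 2 ∧
    Nat.gcd (2 * μ) n = 1 →
  k = 5 ∧ μ = 1 ∧ n = 1

instance (e k μ n : ℕ) : Decidable (SolutionIsTrivial e k μ n) :=
  inferInstanceAs (Decidable (_ → _))

/-- `SolutionIsTrivial` holds throughout the box `e k n ≤ 64`, `μ ≤ 66`. -/
theorem solutionIsTrivial_of_mul_mul_le_sixty_four :
    ∀ e < 65, ∀ k < 64 / e + 1, ∀ n < 64 / (e * k) + 1, ∀ μ < 67,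
      SolutionIsTrivial e k μ n := by
  decide +kernel

/-- `SolutionIsTrivial` holds throughout the box `e k μ ≤ 16`, `n ≤ 22`. -/
theorem solutionIsTrivial_of_mul_mul_le_sixteen :
    ∀ e < 17, ∀ k < 16 / e + 1, ∀ μ < 16 / (e * k) + 1, ∀ n < 23,
      SolutionIsTrivial e k μ n := by
  decide +kernel

theorem stmt_11 (k μ n s : ℤ) (hk : 0 < k) (hkodd : Odd k) (hμ : 0 < μ)
    (hn : 0 < n) (hcop : IsCoprime (2 * μ) n) (hs : 0 ≤ s)
    (heq : k ^ 4 * μ ^ 4 * n ^ 4 - 16 * k * (4 * μ ^ 2 + n ^ 2) = s ^ 2) :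
    k = 5 ∧ μ = 1 ∧ n = 1 := by
  have hnodd : n % 2 = 1 := by
    have h2 : IsCoprime (2 : ℤ) n := hcop.of_isCoprime_of_dvd_left (dvd_mul_right 2 μ)
    rcases Int.emod_two_eq_zero_or_one n with h | h
    · have := h2.isUnit_of_dvd' dvd_rfl (Int.dvd_of_emod_eq_zero h)
      exact absurd this (by decide)
    · exact h
  have hkodd' : k % 2 = 1 := Int.odd_iff.mp hkodd
  obtain ⟨e, he⟩ : Even (k ^ 2 * μ ^ 2 * n ^ 2 - s) := by
    have h : Even ((k ^ 2 * μ ^ 2 * n ^ 2) ^ 2 - s ^ 2) :=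
      ⟨8 * k * (4 * μ ^ 2 + n ^ 2), by linear_combination heq⟩
    simpa [Int.even_sub, Int.even_pow] using h
  obtain rfl : s = k ^ 2 * μ ^ 2 * n ^ 2 - 2 * e := by linarith
  have hE : e * (k ^ 2 * μ ^ 2 * n ^ 2) = 4 * k * (4 * μ ^ 2 + n ^ 2) + e ^ 2 := by
    linarith
  have hX : 0 < k ^ 2 * μ ^ 2 * n ^ 2 := by positivity
  have he0 : 0 < e := by
    refine pos_of_mul_pos_left (b := k ^ 2 * μ ^ 2 * n ^ 2) ?_ hX.le
    rw [hE]
    positivity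
  have hbound : e * k * μ ^ 2 * n ^ 2 ≤ 32 * μ ^ 2 + 8 * n ^ 2 := by
    refine le_of_mul_le_mul_left ?_ hk
    nlinarith [mul_nonneg he0.le hs]
  have hgcd : Int.gcd (2 * μ) n = 1 := Int.isCoprime_iff_gcd_eq_one.mp hcop
  rcases le_total n (2 * μ) with hle | hle
  · have h64 : e * k * n ^ 2 ≤ 64 := by
      refine le_of_mul_le_mul_right ?_ (show 0 < μ ^ 2 by positivity)
      nlinarith
    have hek : e * k ≤ 64 := by
      nlinarith [mul_pos he0 hk, show 1 ≤ n ^ 2 from one_le_pow₀ hn]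
    have he64 : e ≤ 64 := by nlinarith
    have hμ67 : μ < 67 := by
      have hc := Int.le_of_dvd (a := μ ^ 2) (b := 4 * k * n ^ 2 + e ^ 2) (by positivity)
        ⟨e * k ^ 2 * n ^ 2 - 16 * k, by linear_combination -hE⟩
      have : k * n ^ 2 ≤ 64 := by nlinarith [mul_pos hk (pow_pos hn 2)]
      nlinarith
    lift e to ℕ using he0.le
    lift k to ℕ using hk.le
    lift μ to ℕ using hμ.le
    lift n to ℕ using hn.le
    norm_cast at *
    have hk' : k ≤ 64 / e := (Nat.le_div_iff_mul_le he0).mpr (by linarith)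
    have hn' : n ≤ 64 / (e * k) :=
      (Nat.le_div_iff_mul_le (Nat.mul_pos he0 hk)).mpr
        ((Nat.mul_le_mul_right _ (Nat.le_self_pow two_ne_zero n)).trans (by linarith))
    exact solutionIsTrivial_of_mul_mul_le_sixty_four e (by omega) k (by omega) n (by omega)
      μ hμ67 ⟨he0, hkodd', hnodd, hμ, hE, hgcd⟩
  · have h16 : e * k * μ ^ 2 ≤ 16 := by
      refine le_of_mul_le_mul_right ?_ (show 0 < n ^ 2 by positivity)
      nlinarith
    have hek : e * k ≤ 16 := by
      nlinarith [mul_pos he0 hk, show 1 ≤ μ ^ 2 from one_le_pow₀ hμ]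
    have he16 : e ≤ 16 := by nlinarith
    have hn23 : n < 23 := by
      have hc := Int.le_of_dvd (a := n ^ 2) (b := 16 * k * μ ^ 2 + e ^ 2) (by positivity)
        ⟨e * k ^ 2 * μ ^ 2 - 4 * k, by linear_combination -hE⟩
      have : k * μ ^ 2 ≤ 16 := by nlinarith [mul_pos hk (pow_pos hμ 2)]
      nlinarith
    lift e to ℕ using he0.le
    lift k to ℕ using hk.le
    lift μ to ℕ using hμ.le
    lift n to ℕ using hn.le
    norm_cast at *
    have hk' : k ≤ 16 / e := (Nat.le_div_iff_mul_le he0).mpr (by linarith)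
    have hμ' : μ ≤ 16 / (e * k) :=
      (Nat.le_div_iff_mul_le (Nat.mul_pos he0 hk)).mpr
        ((Nat.mul_le_mul_right _ (Nat.le_self_pow two_ne_zero μ)).trans (by linarith))
    exact solutionIsTrivial_of_mul_mul_le_sixteen e (by omega) k (by omega) μ (by omega)
      n hn23 ⟨he0, hkodd', hnodd, hμ, hE, hgcd⟩
end

section
/- Let x, a, k, m, n be positive integers with m and n coprime and n > m, and suppose x² = k(m² + n²) and 4a = k(n² − m²). Then k is even. -/
theorem stmt_12 (x a k m n : ℤ) (hx : 0 < x) (ha : 0 < a) (hk : 0 < k)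
    (hm : 0 < m) (hn : 0 < n) (hcop : IsCoprime m n) (hnm : n > m)
    (h1 : x ^ 2 = k * (m ^ 2 + n ^ 2)) (h2 : 4 * a = k * (n ^ 2 - m ^ 2)) :
    Even k := by
  by_contra hk_even
  have hparity : Even n ↔ Even m := by
    have h : Even (k * (n ^ 2 - m ^ 2)) := h2 ▸ (by decide : Even (4 : ℤ)).mul_right a
    simpa [Int.even_mul, Int.even_sub, Int.even_pow, hk_even] using h
  have hm_odd : ¬ Even m := fun h =>
    Int.prime_two.not_isUnit (hcop.isUnit_of_dvd' h.two_dvd (hparity.2 h).two_dvd)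
  have hn_odd : ¬ Even n := fun h => hm_odd (hparity.1 h)
  rw [Int.not_even_iff_odd] at hk_even hm_odd hn_odd
  obtain ⟨r, rfl⟩ := hk_even
  obtain ⟨s, rfl⟩ := hm_odd
  obtain ⟨t, rfl⟩ := hn_odd
  have hx_even : Even x := by
    have h : Even (x ^ 2) := ⟨(2 * r + 1) * (2 * s ^ 2 + 2 * s + 2 * t ^ 2 + 2 * t + 1), by
      rw [h1]; ring⟩
    exact (Int.even_pow.1 h).1
  obtain ⟨y, rfl⟩ := hx_even
  have h : 2 * y ^ 2 =
      2 * (r * (2 * s ^ 2 + 2 * s + 2 * t ^ 2 + 2 * t + 1) + s ^ 2 + s + t ^ 2 + t) + 1 := by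
    linarith
  omega
end

section
/- Let κ, m, n be positive integers and s a nonnegative integer satisfying κ⁴m⁴n⁴ − 32κ(m² + n²) = s². Then κ²m²n² − s ≥ 8; that is, κ²m²n² − s cannot equal 2, 4, or 6. -/
theorem sq_emod_eight (w : ℤ) : w ^ 2 % 8 = 0 ∨ w ^ 2 % 8 = 1 ∨ w ^ 2 % 8 = 4 := by
  have h : w % 8 = 0 ∨ w % 8 = 1 ∨ w % 8 = 2 ∨ w % 8 = 3 ∨ w % 8 = 4 ∨ w % 8 = 5 ∨
      w % 8 = 6 ∨ w % 8 = 7 := by omega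
  rcases h with h | h | h | h | h | h | h | h <;> simp [pow_two, Int.mul_emod, h]

theorem eight_mul_sq_add_sq_ne_of_le {m n : ℤ} (hm : 0 < m) (hmn : m ≤ n) :
    8 * (m ^ 2 + n ^ 2) ≠ m ^ 2 * n ^ 2 - 1 := by
  intro h
  have hm4 : m ≤ 4 := by
    by_contra! h5
    have h1 : 25 ≤ m ^ 2 := by nlinarith
    have h2 : 25 ≤ n ^ 2 := by nlinarith
    nlinarith [mul_nonneg (sub_nonneg.2 h1) (sub_nonneg.2 h2)]
  have hn : n ^ 2 ≠ 73 := by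
    intro h73
    have h8 : 8 < n := by nlinarith
    have h9 : n < 9 := by nlinarith
    omega
  interval_cases m
  · nlinarith
  · nlinarith
  · omega
  · omega

theorem eight_mul_sq_add_sq_ne {m n : ℤ} (hm : 0 < m) (hn : 0 < n) :
    8 * (m ^ 2 + n ^ 2) ≠ m ^ 2 * n ^ 2 - 1 := by
  rcases le_total m n with h | h
  · exact eight_mul_sq_add_sq_ne_of_le hm h
  · rw [add_comm, mul_comm (m ^ 2)]
    exact eight_mul_sq_add_sq_ne_of_le hn h

theorem stmt_13 (κ m n s : ℤ) (hκ : 0 < κ) (hm : 0 < m) (hn : 0 < n)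
    (hs : 0 ≤ s) (heq : κ ^ 4 * m ^ 4 * n ^ 4 - 32 * κ * (m ^ 2 + n ^ 2) = s ^ 2) :
    κ ^ 2 * m ^ 2 * n ^ 2 - s ≥ 8 := by
  have hw := sq_emod_eight (κ * m * n)
  rw [mul_pow, mul_pow] at hw
  obtain ⟨d, hd⟩ : ∃ d, d = κ ^ 2 * m ^ 2 * n ^ 2 - s := ⟨_, rfl⟩
  obtain ⟨P, hP⟩ : ∃ P, P = κ ^ 2 * m ^ 2 * n ^ 2 := ⟨_, rfl⟩
  obtain ⟨T, hT⟩ : ∃ T, T = κ * (m ^ 2 + n ^ 2) := ⟨_, rfl⟩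
  have hT0 : 0 < T := by rw [hT]; positivity
  have hP0 : 0 < P := by rw [hP]; positivity
  have key : 32 * T = d * (2 * P - d) := by
    rw [hT, hd, hP]
    linear_combination -heq
  rw [← hP] at hd hw ⊢
  rw [← hd]
  by_contra! h8
  have hd0 : 0 < d := by
    by_contra! h
    nlinarith [mul_nonneg (neg_nonneg.2 h) (show 0 ≤ 2 * P - d by omega)]
  interval_cases d
  · omega
  · have h1 : 8 * T = P - 1 := by omega
    have hκ1 : κ ∣ 1 := ⟨κ * m ^ 2 * n ^ 2 - 8 * (m ^ 2 + n ^ 2), by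
      rw [hT, hP] at h1
      linear_combination h1⟩
    obtain rfl : κ = 1 := Int.eq_one_of_dvd_one hκ.le hκ1
    apply eight_mul_sq_add_sq_ne hm hn
    rw [hT, hP] at h1
    linear_combination h1
  all_goals omega
end

section
/- Let k, μ, n be positive integers with k odd, and let s be a nonnegative integer satisfying k⁴μ⁴n⁴ − 16k(4μ² + n²) = s². Then k²μ²n² − s ≥ 10; that is, k²μ²n² − s cannot equal 2, 4, 6, or 8. -/
/-- A factorisation `(p x² - a)(p y² - b) = N` with `N > 0` bounds both `x` and `y`. -/
lemma bounds_of_shifted_squares_mul_eq {p a b N m x y : ℤ} (hp : 0 < p) (hN : 0 < N) (hm : 0 ≤ m)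
    (ha : N + a < p * m ^ 2) (hb : N + b < p * m ^ 2)
    (h : (p * x ^ 2 - a) * (p * y ^ 2 - b) = N) : x < m ∧ y < m := by
  have h1 : p * x ^ 2 - a ≤ N := Int.le_of_dvd hN ⟨_, h.symm⟩
  have h2 : p * y ^ 2 - b ≤ N := Int.le_of_dvd hN (Dvd.intro_left _ h)
  constructor
  · exact lt_of_pow_lt_pow_left₀ 2 hm (lt_of_mul_lt_mul_left (by linarith) hp.le)
  · exact lt_of_pow_lt_pow_left₀ 2 hm (lt_of_mul_lt_mul_left (by linarith) hp.le)

theorem stmt_14 (k μ n s : ℤ) (hk : 0 < k) (hkodd : Odd k) (hμ : 0 < μ)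
    (hn : 0 < n) (hs : 0 ≤ s)
    (heq : k ^ 4 * μ ^ 4 * n ^ 4 - 16 * k * (4 * μ ^ 2 + n ^ 2) = s ^ 2) :
    k ^ 2 * μ ^ 2 * n ^ 2 - s ≥ 10 := by
  by_contra! hlt
  obtain ⟨d, hd⟩ : ∃ d, d = k ^ 2 * μ ^ 2 * n ^ 2 - s := ⟨_, rfl⟩
  have hP : 0 < k ^ 2 * μ ^ 2 * n ^ 2 := by positivity
  have hfac : d * (2 * (k ^ 2 * μ ^ 2 * n ^ 2) - d) = 16 * k * (4 * μ ^ 2 + n ^ 2) := by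
    rw [hd]; linear_combination heq
  have hpos : 0 < d := by
    have : 0 < 16 * k * (4 * μ ^ 2 + n ^ 2) := by positivity
    rw [← hfac] at this
    exact pos_of_mul_pos_left this (by linarith)
  have heven : Even d := by
    have h : Even (d * (2 * (k ^ 2 * μ ^ 2 * n ^ 2) - d)) :=
      hfac ▸ ⟨8 * k * (4 * μ ^ 2 + n ^ 2), by ring⟩
    rcases Int.even_mul.1 h with h | h
    · exact h
    · simpa [Int.even_sub] using h
  obtain ⟨t, rfl⟩ := heven
  have ht : t < 5 := by linarith
  have ht0 : 0 < t := by linarith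
  have ht2 : t * (k ^ 2 * μ ^ 2 * n ^ 2 - t) = 4 * k * (4 * μ ^ 2 + n ^ 2) := by
    linarith
  have hkt : k ∣ t ^ 2 :=
    ⟨t * k * μ ^ 2 * n ^ 2 - 4 * (4 * μ ^ 2 + n ^ 2), by linear_combination -ht2⟩
  have hkle : k ≤ t ^ 2 := Int.le_of_dvd (by positivity) hkt
  clear hd hlt hfac heq
  have hkt' : k = 1 ∨ t = 3 ∧ (k = 3 ∨ k = 9) := by
    rw [Int.odd_iff] at hkodd
    interval_cases t <;> norm_num at hkle <;> interval_cases k <;> omega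
  rcases hkt' with rfl | ⟨rfl, rfl | rfl⟩
  · interval_cases t
    · obtain ⟨h1, h2⟩ := bounds_of_shifted_squares_mul_eq (p := 1) (a := 4) (b := 16) (N := 65)
        (m := 10) (x := μ) (y := n) (by norm_num) (by norm_num) (by norm_num) (by norm_num)
        (by norm_num) (by linear_combination ht2)
      interval_cases μ <;> interval_cases n <;> omega
    · obtain ⟨h1, h2⟩ := bounds_of_shifted_squares_mul_eq (p := 1) (a := 2) (b := 8) (N := 18)
        (m := 6) (x := μ) (y := n) (by norm_num) (by norm_num) (by norm_num) (by norm_num)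
        (by norm_num) (by linarith)
      interval_cases μ <;> interval_cases n <;> omega
    · obtain ⟨h1, h2⟩ := bounds_of_shifted_squares_mul_eq (p := 3) (a := 4) (b := 16) (N := 91)
        (m := 7) (x := μ) (y := n) (by norm_num) (by norm_num) (by norm_num) (by norm_num)
        (by norm_num) (by linear_combination 3 * ht2)
      interval_cases μ <;> interval_cases n <;> omega
    · obtain ⟨h1, h2⟩ := bounds_of_shifted_squares_mul_eq (p := 1) (a := 1) (b := 4) (N := 8)
        (m := 4) (x := μ) (y := n) (by norm_num) (by norm_num) (by norm_num) (by norm_num)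
        (by norm_num) (by linarith)
      interval_cases μ <;> interval_cases n <;> omega
  · obtain ⟨h1, h2⟩ := bounds_of_shifted_squares_mul_eq (p := 9) (a := 4) (b := 16) (N := 91)
      (m := 4) (x := μ) (y := n) (by norm_num) (by norm_num) (by norm_num) (by norm_num)
      (by norm_num) (by linarith)
    interval_cases μ <;> interval_cases n <;> omega
  · have h1 : 1 ≤ μ ^ 2 := one_le_pow₀ hμ
    have h2 : 1 ≤ n ^ 2 := one_le_pow₀ hn
    nlinarith [mul_nonneg (sub_nonneg.2 h1) (sub_nonneg.2 h2)]
end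

section
/- For every positive integer n, the integer n⁴ − 32n² − 32 is not the square of an integer. -/
theorem stmt_15 (n : ℤ) (hn : 0 < n) :
    ¬ ∃ s : ℤ, n ^ 4 - 32 * n ^ 2 - 32 = s ^ 2 := by
  rintro ⟨s, hs⟩
  obtain ⟨r, hr, h⟩ : ∃ r : ℤ, 0 ≤ r ∧ (n ^ 2 - 16) ^ 2 - 288 = r ^ 2 :=
    ⟨|s|, abs_nonneg s, by rw [sq_abs]; linarith⟩
  have hn13 : n < 13 := by
    by_contra! hle
    have ht : 153 ≤ n ^ 2 - 16 := by nlinarith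
    generalize n ^ 2 - 16 = t at h ht
    have hlt : r < t := by nlinarith
    have hgt : t - 1 < r := by nlinarith
    omega
  have hr128 : r < 129 := by
    have hn2 : n ^ 2 ≤ 144 := by nlinarith
    nlinarith [sq_nonneg n]
  interval_cases n <;> interval_cases r <;> omega
end

section
/- For every positive integer n, the integer n⁴ − 4n² − 4 is not the square of an integer. -/
theorem stmt_16 (n : ℤ) (hn : 0 < n) :
    ¬ ∃ t : ℤ, n ^ 4 - 4 * n ^ 2 - 4 = t ^ 2 := by
  rintro ⟨t, ht⟩
  by_cases h : n < 3
  · interval_cases n <;> nlinarith [sq_nonneg t]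
  · have ha : 7 ≤ n ^ 2 - 2 := by nlinarith
    have key : |t| ^ 2 = (n ^ 2 - 2) ^ 2 - 8 := by
      rw [sq_abs, ← ht]
      ring
    have hlt : |t| < n ^ 2 - 2 := by
      refine lt_of_pow_lt_pow_left₀ 2 (by linarith) ?_
      linarith
    have hle : |t| ≤ n ^ 2 - 2 - 1 := by linarith [Int.add_one_le_iff.mpr hlt]
    have hsq : |t| ^ 2 ≤ (n ^ 2 - 2 - 1) ^ 2 := pow_le_pow_left₀ (abs_nonneg t) hle 2
    linarith
end

section
/- For every positive integer μ, the integer μ⁴ − 64μ² − 16 is not the square of an integer. -/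
theorem stmt_17 (μ : ℤ) (hμ : 0 < μ) :
    ¬ ∃ s : ℤ, μ ^ 4 - 64 * μ ^ 2 - 16 = s ^ 2 := by
  rintro ⟨s, hs⟩
  have hμ_lt : μ < 24 := by
    by_contra! h
    have ht : 544 ≤ μ ^ 2 - 32 := by nlinarith
    have hdiff : (μ ^ 2 - 32) ^ 2 = |s| ^ 2 + 1040 := by rw [sq_abs]; linarith
    have hlt : |s| < μ ^ 2 - 32 := lt_of_pow_lt_pow_left₀ 2 (by linarith) (by linarith)
    nlinarith [abs_nonneg s]
  have hsq : IsSquare (μ ^ 4 - 64 * μ ^ 2 - 16) := ⟨s, by rw [hs, sq]⟩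
  clear hs
  interval_cases μ <;> norm_num at hsq
end

section
/- For every positive integer n, the integer n⁴ − 16n² − 64 is not the square of an integer. -/
theorem stmt_18 (n : ℤ) (hn : 0 < n) :
    ¬ ∃ s : ℤ, n ^ 4 - 16 * n ^ 2 - 64 = s ^ 2 := by
  rintro ⟨s, hs⟩
  rw [← sq_abs s] at hs
  have h_nonneg : 0 ≤ |s| := abs_nonneg s
  generalize |s| = t at hs h_nonneg
  have h_factor : (n ^ 2 - 8) ^ 2 - t ^ 2 = 128 := by linear_combination hs
  have hn_le : n ≤ 8 := by
    by_contra! h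
    have h_large : 73 ≤ n ^ 2 - 8 := by nlinarith
    have h_lt : t < n ^ 2 - 8 := by nlinarith
    nlinarith
  have ht_le : t ≤ 56 := by
    have h_upper : n ^ 2 - 8 ≤ 56 := by nlinarith
    have h_lower : -7 ≤ n ^ 2 - 8 := by nlinarith
    nlinarith
  interval_cases n <;> interval_cases t <;> omega
end

section
/- For every positive integer μ, the integer 81μ⁴ − 192μ² − 48 is not the square of an integer. -/
theorem stmt_19 (μ : ℤ) (hμ : 0 < μ) :
    ¬ ∃ s : ℤ, 81 * μ ^ 4 - 192 * μ ^ 2 - 48 = s ^ 2 := by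
  rintro ⟨s, hs⟩
  have no_solution_mod_nine :
      ∀ m t : ZMod 9, 81 * m ^ 4 - 192 * m ^ 2 - 48 ≠ t ^ 2 := by decide
  exact no_solution_mod_nine μ s (mod_cast congrArg (Int.cast : ℤ → ZMod 9) hs)
end
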